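/- arXiv:2011.09511 — 2 statements merged into one kernel-verified Lean document; each statement's English description precedes it below -/
import Mathlib

section
/- Let x : U → ℝ³ be a proper wavefront, Ω a tmb of x, and p ∈ Σ(x) a non-degenerated singularity (i.e. Dλ_Ω(p) ≠ (0,0)) with rank(Dx(p)) = 1. Then the following are equivalent: (1) the Gaussian curvature K admits a C^∞ extension to some open neighborhood of p; (2) K is bounded on W − Σ(x) for some neighborhood W of p; (3) K_Ω vanishes on V ∩ Σ(x) for some neighborhood V of p; (4) the coefficients e, f, g of the second fundamental form of x all vanish on V ∩ Σ(x) for some neighborhood V of p. -/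
/- Common framework for frontals and tangent moving bases, following
   "Curvatures on fronts" conventions. -/

noncomputable section

open Matrix Topology Filter

/-- Points of the plane ℝ². -/
abbrev Pt : Type := Fin 2 → ℝ

/-- Jacobian matrix of a map `f : ℝ² → ℝ^m` at a point. -/
def jac {m : ℕ} (f : Pt → (Fin m → ℝ)) (p : Pt) : Matrix (Fin m) (Fin 2) ℝ :=
  Matrix.of fun i j => fderiv ℝ f p (Pi.single j 1) i

/-- Euclidean norm of a vector in ℝ³. -/
def enorm3 (v : Fin 3 → ℝ) : ℝ := Real.sqrt (v ⬝ᵥ v)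

/-- The unit normal vector field induced by a tangent moving base `Ω`,
    `n := (w₁ × w₂)/‖w₁ × w₂‖` where `w₁, w₂` are the columns of `Ω`. -/
def normalOf (Ω : Pt → Matrix (Fin 3) (Fin 2) ℝ) (p : Pt) : Fin 3 → ℝ :=
  (enorm3 (crossProduct (fun i => Ω p i 0) (fun i => Ω p i 1)))⁻¹ •
    crossProduct (fun i => Ω p i 0) (fun i => Ω p i 1)

/-- First fundamental form matrix of a map `y`. -/
def IOf (y : Pt → Fin 3 → ℝ) (p : Pt) : Matrix (Fin 2) (Fin 2) ℝ :=
  (jac y p)ᵀ * jac y p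

/-- Second fundamental form matrix of a map `y` with respect to a unit normal `ν`. -/
def IIOf (y ν : Pt → Fin 3 → ℝ) (p : Pt) : Matrix (Fin 2) (Fin 2) ℝ :=
  -((jac y p)ᵀ * jac ν p)

/-- Weingarten matrix `α := −IIᵀ I⁻¹` of a map `y` with unit normal `ν`. -/
def weinOf (y ν : Pt → Fin 3 → ℝ) (p : Pt) : Matrix (Fin 2) (Fin 2) ℝ :=
  -((IIOf y ν p)ᵀ * (IOf y p)⁻¹)

/-- Gaussian curvature of an immersion `y` with unit normal `ν`. -/
def KgOf (y ν : Pt → Fin 3 → ℝ) (p : Pt) : ℝ :=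
  (IIOf y ν p).det / (IOf y p).det

/-- Mean curvature of an immersion `y` with unit normal `ν`. -/
def HmOf (y ν : Pt → Fin 3 → ℝ) (p : Pt) : ℝ :=
  -(1 / 2) * (weinOf y ν p).trace

/-- Smaller principal curvature `H − √(H² − K)` of an immersion `y`. -/
def k1Of (y ν : Pt → Fin 3 → ℝ) (p : Pt) : ℝ :=
  HmOf y ν p - Real.sqrt ((HmOf y ν p) ^ 2 - KgOf y ν p)

/-- Larger principal curvature `H + √(H² − K)` of an immersion `y`. -/
def k2Of (y ν : Pt → Fin 3 → ℝ) (p : Pt) : ℝ :=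
  HmOf y ν p + Real.sqrt ((HmOf y ν p) ^ 2 - KgOf y ν p)

/-- A frontal `x : U → ℝ³` equipped with a tangent moving base (tmb) `Ω` and the
induced smooth matrix-valued maps `Λ`, `μ` satisfying `Dx = Ω Λᵀ` and `Dn = Ω μᵀ` on `U`. -/
structure Frontal where
  /-- the domain -/
  U : Set Pt
  isOpen_U : IsOpen U
  /-- the frontal -/
  x : Pt → Fin 3 → ℝ
  /-- the tangent moving base -/
  Ω : Pt → Matrix (Fin 3) (Fin 2) ℝ
  /-- `Λ` with `Dx = Ω Λᵀ` -/
  Λ : Pt → Matrix (Fin 2) (Fin 2) ℝ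
  /-- `μ` with `Dn = Ω μᵀ` -/
  μ : Pt → Matrix (Fin 2) (Fin 2) ℝ
  smooth_x : ContDiffOn ℝ (⊤ : ℕ∞) x U
  smooth_Ω : ∀ i j, ContDiffOn ℝ (⊤ : ℕ∞) (fun p => Ω p i j) U
  smooth_Λ : ∀ i j, ContDiffOn ℝ (⊤ : ℕ∞) (fun p => Λ p i j) U
  smooth_μ : ∀ i j, ContDiffOn ℝ (⊤ : ℕ∞) (fun p => μ p i j) U
  /-- the columns of `Ω` are linearly independent (nonzero cross product) -/
  indep : ∀ p ∈ U, crossProduct (fun i => Ω p i 0) (fun i => Ω p i 1) ≠ 0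
  decomp_x : ∀ p ∈ U, jac x p = Ω p * (Λ p)ᵀ
  decomp_n : ∀ p ∈ U, jac (normalOf Ω) p = Ω p * (μ p)ᵀ

namespace Frontal

variable (F : Frontal)

/-- The unit normal induced by the tmb. -/
def n : Pt → Fin 3 → ℝ := normalOf F.Ω

/-- `λ_Ω := det Λ`. -/
def lam (p : Pt) : ℝ := (F.Λ p).det

/-- The Ω-relative curvature `K_Ω := det μ`. -/
def KΩ (p : Pt) : ℝ := (F.μ p).det

/-- `α_Ω := μ · adj(Λ)`. -/
def αΩ (p : Pt) : Matrix (Fin 2) (Fin 2) ℝ := F.μ p * (F.Λ p).adjugate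

/-- The Ω-relative mean curvature `H_Ω := −(1/2) tr α_Ω`. -/
def HΩ (p : Pt) : ℝ := -(1 / 2) * (F.αΩ p).trace

/-- The relative principal curvature `k_{1Ω} := H_Ω − √(H_Ω² − λ_Ω K_Ω)`. -/
def k1Ω (p : Pt) : ℝ := F.HΩ p - Real.sqrt ((F.HΩ p) ^ 2 - F.lam p * F.KΩ p)

/-- The relative principal curvature `k_{2Ω} := H_Ω + √(H_Ω² − λ_Ω K_Ω)`. -/
def k2Ω (p : Pt) : ℝ := F.HΩ p + Real.sqrt ((F.HΩ p) ^ 2 - F.lam p * F.KΩ p)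

/-- The singular set `Σ(x) = λ_Ω⁻¹(0)`. -/
def sing : Set Pt := {p ∈ F.U | F.lam p = 0}

/-- The regular set `U − Σ(x)`. -/
def reg : Set Pt := {p ∈ F.U | F.lam p ≠ 0}

/-- A frontal is proper if its singular set has empty interior. -/
def IsProper : Prop := interior F.sing = ∅

/-- `x` is a wavefront if `(x, n) : U → ℝ³ × S²` is an immersion. -/
def IsWavefront : Prop :=
  ∀ p ∈ F.U, (Matrix.fromRows (jac F.x p) (jac F.n p)).rank = 2

/-- First fundamental form matrix `I = Dxᵀ Dx`. -/
def Imat (p : Pt) : Matrix (Fin 2) (Fin 2) ℝ := IOf F.x p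

/-- Second fundamental form matrix `II = −Dxᵀ Dn`. -/
def IImat (p : Pt) : Matrix (Fin 2) (Fin 2) ℝ := IIOf F.x F.n p

/-- Weingarten matrix `α := −IIᵀ I⁻¹` (meaningful off the singular set). -/
def Wein (p : Pt) : Matrix (Fin 2) (Fin 2) ℝ := weinOf F.x F.n p

/-- Coefficient `e` of the second fundamental form. -/
def e (p : Pt) : ℝ := F.IImat p 0 0

/-- Coefficient `f` of the second fundamental form. -/
def f (p : Pt) : ℝ := F.IImat p 0 1

/-- Coefficient `g` of the second fundamental form. -/
def g (p : Pt) : ℝ := F.IImat p 1 1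

/-- Gaussian curvature (meaningful off the singular set). -/
def Kg (p : Pt) : ℝ := KgOf F.x F.n p

/-- Mean curvature (meaningful off the singular set). -/
def Hm (p : Pt) : ℝ := HmOf F.x F.n p

/-- Principal curvature `κ₋ := H − √(H² − K)`. -/
def κm (p : Pt) : ℝ := F.Hm p - Real.sqrt ((F.Hm p) ^ 2 - F.Kg p)

/-- Principal curvature `κ₊ := H + √(H² − K)`. -/
def κp (p : Pt) : ℝ := F.Hm p + Real.sqrt ((F.Hm p) ^ 2 - F.Kg p)

/-- `k₁ := κ₋` where `λ_Ω > 0` and `k₁ := κ₊` where `λ_Ω < 0`. -/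
def k1 (p : Pt) : ℝ := if 0 < F.lam p then F.κm p else F.κp p

/-- `k₂ := κ₊` where `λ_Ω > 0` and `k₂ := κ₋` where `λ_Ω < 0`. -/
def k2 (p : Pt) : ℝ := if 0 < F.lam p then F.κp p else F.κm p

/-- `x` is parallelly smoothable at `p` : for some `ε > 0` and some open
neighborhood `V` of `p`, `rank D(x + l·n)(q) = 2` for all `(q,l) ∈ V × (0,ε)`
or for all `(q,l) ∈ V × (−ε,0)`. -/
def ParSmoothable (p : Pt) : Prop :=
  ∃ ε > (0 : ℝ), ∃ V : Set Pt, IsOpen V ∧ p ∈ V ∧ V ⊆ F.U ∧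
    ((∀ q ∈ V, ∀ l ∈ Set.Ioo (0 : ℝ) ε,
        (jac (fun z => F.x z + l • F.n z) q).rank = 2) ∨
     (∀ q ∈ V, ∀ l ∈ Set.Ioo (-ε) (0 : ℝ),
        (jac (fun z => F.x z + l • F.n z) q).rank = 2))

/-- `f` (defined off the singular set) has a `C^∞` extension to `V`. -/
def SmoothExtOn (f : Pt → ℝ) (V : Set Pt) : Prop :=
  ∃ g : Pt → ℝ, ContDiffOn ℝ (⊤ : ℕ∞) g V ∧ ∀ q ∈ V ∩ F.reg, g q = f q

/-- `f` has a `C^∞` extension to some open neighborhood of `p`. -/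
def SmoothExtNear (f : Pt → ℝ) (p : Pt) : Prop :=
  ∃ V : Set Pt, IsOpen V ∧ p ∈ V ∧ V ⊆ F.U ∧ F.SmoothExtOn f V

/-- Membership in the principal ideal `𝔗_Ω(V)` generated by `λ_Ω` in `C^∞(V,ℝ)`. -/
def memIdeal (f : Pt → ℝ) (V : Set Pt) : Prop :=
  ∃ φ : Pt → ℝ, ContDiffOn ℝ (⊤ : ℕ∞) φ V ∧ ∀ q ∈ V, f q = φ q * F.lam q

end Frontal

/-- `f` does not change sign on `V`. -/
def NoSignChange (f : Pt → ℝ) (V : Set Pt) : Prop :=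
  (∀ q ∈ V, 0 ≤ f q) ∨ (∀ q ∈ V, f q ≤ 0)


theorem hasFDerivAt_intervalIntegral_of_contDiff {E F : Type*} [NormedAddCommGroup E]
    [NormedSpace ℝ E] [ProperSpace E] [NormedAddCommGroup F] [NormedSpace ℝ F]
    {g : E × ℝ → F} (hg : ContDiff ℝ 1 g) (x : E) :
    HasFDerivAt (fun y => ∫ t in (0 : ℝ)..1, g (y, t))
      (∫ t in (0 : ℝ)..1, (fderiv ℝ g (x, t)).comp (ContinuousLinearMap.inl ℝ E ℝ)) x := by
  have hc : Continuous fun z => (fderiv ℝ g z).comp (ContinuousLinearMap.inl ℝ E ℝ) :=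
    (hg.continuous_fderiv one_ne_zero).clm_comp continuous_const
  obtain ⟨C, hC⟩ := ((isCompact_closedBall x 1).prod
    (isCompact_Icc (a := (0 : ℝ)) (b := 1))).exists_bound_of_continuousOn hc.continuousOn
  have hgc : ∀ y, Continuous fun t : ℝ => g (y, t) := fun y =>
    hg.continuous.comp (by fun_prop)
  refine intervalIntegral.hasFDerivAt_integral_of_dominated_of_fderiv_le
    (F := fun y t => g (y, t)) (bound := fun _ => C)
    (F' := fun y t => (fderiv ℝ g (y, t)).comp (ContinuousLinearMap.inl ℝ E ℝ))
    (Metric.closedBall_mem_nhds x one_pos) ?_ ?_ ?_ ?_ ?_ ?_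
  · exact Eventually.of_forall fun y => (hgc y).aestronglyMeasurable
  · exact (hgc x).intervalIntegrable _ _
  · exact (hc.comp (by fun_prop : Continuous fun t : ℝ => (x, t))).aestronglyMeasurable
  · refine Eventually.of_forall fun t ht y hy => hC (y, t) ⟨hy, ?_⟩
    rw [Set.uIoc_of_le zero_le_one] at ht
    exact Set.Ioc_subset_Icc_self ht
  · exact intervalIntegrable_const
  · refine Eventually.of_forall fun t _ y _ => ?_
    have h := (hg.differentiable one_ne_zero (y, t)).hasFDerivAt
    exact h.comp y (hasFDerivAt_prodMk_left y t)

theorem ContDiff.intervalIntegral_nat {E F : Type} [NormedAddCommGroup E]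
    [NormedSpace ℝ E] [ProperSpace E] (n : ℕ) [NormedAddCommGroup F]
    [NormedSpace ℝ F] {g : E × ℝ → F} (hg : ContDiff ℝ n g) :
    ContDiff ℝ n fun y => ∫ t in (0 : ℝ)..1, g (y, t) := by
  induction n generalizing F with
  | zero =>
    have := hg.continuous
    refine contDiff_zero.2 ?_
    exact intervalIntegral.continuous_parametric_intervalIntegral_of_continuous'
      (f := fun y t => g (y, t)) this 0 1
  | succ n ih =>
    push_cast at hg ⊢
    refine contDiff_succ_iff_hasFDerivAt.2
      ⟨_, ih (g := fun z => (fderiv ℝ g z).comp (ContinuousLinearMap.inl ℝ E ℝ)) ?_,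
        hasFDerivAt_intervalIntegral_of_contDiff (hg.of_le (by simp))⟩
    exact (hg.fderiv_right le_rfl).clm_comp contDiff_const

theorem exists_smooth_div_of_eq_zero_on_zeroLocus {E : Type} [NormedAddCommGroup E]
    [NormedSpace ℝ E] [FiniteDimensional ℝ E] {U : Set E} (hU : IsOpen U) {p : E} (hp : p ∈ U)
    {l h : E → ℝ} (hl : ContDiffOn ℝ (⊤ : ℕ∞) l U) (hh : ContDiffOn ℝ (⊤ : ℕ∞) h U)
    (hd : fderiv ℝ l p ≠ 0) (hz : ∀ q ∈ U, l q = 0 → h q = 0) :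
    ∃ V, IsOpen V ∧ p ∈ V ∧ V ⊆ U ∧ ∃ φ : E → ℝ, ContDiffOn ℝ (⊤ : ℕ∞) φ V ∧
      ∀ q ∈ V, h q = φ q * l q := by
  set D := fderiv ℝ l p with hD
  obtain ⟨v, hv⟩ : ∃ v, D v = 1 := by
    obtain ⟨w, hw⟩ := DFunLike.ne_iff.1 hd
    exact ⟨(D w)⁻¹ • w, by simpa using inv_mul_cancel₀ hw⟩
  -- `Ψ` straightens `l` to the linear form `D`.
  set Ψ : E → E := fun q => q + (l q - D q) • v with hΨ
  have hΨD : ∀ q, D (Ψ q) = l q := by intro q; simp [hΨ, hv]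
  have hΨs : ContDiffOn ℝ (⊤ : ℕ∞) Ψ U :=
    contDiffOn_id.add ((hl.sub D.contDiff.contDiffOn).smul contDiffOn_const)
  have hΨa : ∀ q ∈ U, ContDiffAt ℝ (⊤ : ℕ∞) Ψ q := fun q hq => hΨs.contDiffAt (hU.mem_nhds hq)
  have hΨp : HasFDerivAt Ψ ((ContinuousLinearEquiv.refl ℝ E : E ≃L[ℝ] E) : E →L[ℝ] E) p := by
    have hlp : HasFDerivAt l D p :=
      ((hl.contDiffAt (hU.mem_nhds hp)).differentiableAt (by simp)).hasFDerivAt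
    have := (hasFDerivAt_id p).add ((hlp.sub D.hasFDerivAt).smul_const v)
    convert! this using 1
    ext; simp
  set Φ := (hΨa p hp).toOpenPartialHomeomorph Ψ hΨp (by simp) with hΦ
  have hΦc : ∀ q, Φ q = Ψ q := fun q => rfl
  have hpS : p ∈ Φ.source := (hΨa p hp).mem_toOpenPartialHomeomorph_source hΨp (by simp)
  -- a neighbourhood of `p` on which the derivative of `Ψ` is invertible
  have hinv : ∀ᶠ q in 𝓝 p, q ∈ U ∧ ∃ e : E ≃L[ℝ] E, HasFDerivAt Ψ (e : E →L[ℝ] E) q := by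
    have hcont : ContinuousAt (fderiv ℝ Ψ) p :=
      ((hΨa p hp).fderiv_right (m := 0) (by simp)).continuousAt
    have h1 := hcont.eventually_mem
      (s := Set.range ((↑) : (E ≃L[ℝ] E) → E →L[ℝ] E)) (by
        rw [hΨp.fderiv]; exact ContinuousLinearEquiv.nhds _)
    filter_upwards [h1, hU.mem_nhds hp] with q ⟨e, he⟩ hqU
    refine ⟨hqU, e, ?_⟩
    rw [he]
    exact ((hΨa q hqU).differentiableAt (by simp)).hasFDerivAt
  have hT : ∀ᶠ y in 𝓝 (Ψ p), y ∈ Φ.target ∧ Φ.symm y ∈ U ∧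
      ∃ e : E ≃L[ℝ] E, HasFDerivAt Ψ (e : E →L[ℝ] E) (Φ.symm y) := by
    have h1 : Φ.target ∈ 𝓝 (Ψ p) := Φ.open_target.mem_nhds (Φ.map_source hpS)
    have h2 : Tendsto Φ.symm (𝓝 (Ψ p)) (𝓝 p) := Φ.tendsto_symm hpS
    filter_upwards [h1, h2.eventually hinv] with y hy hy' using ⟨hy, hy'⟩
  obtain ⟨ε, hε, hball⟩ := Metric.eventually_nhds_iff_ball.1 hT
  let χ : ContDiffBump (Ψ p) := ⟨ε / 4, ε / 2, by positivity, by linarith⟩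
  have hχ : ∀ y, y ∉ Metric.ball (Ψ p) ε → χ =ᶠ[𝓝 y] 0 := by
    intro y hy
    rw [← notMem_tsupport_iff_eventuallyEq, χ.tsupport_eq]
    exact fun h => hy (Metric.closedBall_subset_ball (by simp [χ, hε]) h)
  -- `h` in the new coordinates, cut off to a global smooth function
  set H : E → ℝ := fun y => χ y * h (Φ.symm y) with hH
  have hHs : ContDiff ℝ (⊤ : ℕ∞) H := by
    rw [contDiff_iff_contDiffAt]
    intro y
    by_cases hy : y ∈ Metric.ball (Ψ p) ε
    · obtain ⟨hyT, hyU, e, he⟩ := hball y hy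
      exact χ.contDiffAt.mul ((hh.contDiffAt (hU.mem_nhds hyU)).comp y
        (Φ.contDiffAt_symm hyT he (hΨa _ hyU)))
    · refine (contDiffAt_const (c := (0 : ℝ))).congr_of_eventuallyEq ?_
      filter_upwards [hχ y hy] with z hz
      simp [hH, hz]
  have hHz : ∀ y, D y = 0 → H y = 0 := by
    intro y hDy
    by_cases hy : y ∈ Metric.ball (Ψ p) ε
    · obtain ⟨hyT, hyU, -⟩ := hball y hy
      have : l (Φ.symm y) = 0 := by
        rw [← hΨD, ← hΦc, Φ.right_inv hyT, hDy]
      simp [hH, hz _ hyU this]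
    · simp [hH, (hχ y hy).eq_of_nhds]
  set G : E → ℝ := fun y => ∫ t in (0 : ℝ)..1, fderiv ℝ H (y - (t * D y) • v) v with hG
  have hGs : ContDiff ℝ (⊤ : ℕ∞) G := by
    rw [contDiff_infty]
    intro n
    refine ContDiff.intervalIntegral_nat n
      (g := fun z : E × ℝ => fderiv ℝ H (z.1 - (z.2 * D z.1) • v) v) ?_
    have h1 : ContDiff ℝ n (fderiv ℝ H) := hHs.fderiv_right (by exact_mod_cast le_top)
    exact (h1.comp (contDiff_fst.sub
      ((contDiff_snd.mul (D.contDiff.comp contDiff_fst)).smul contDiff_const))).clm_apply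
      contDiff_const
  have hHG : ∀ y, H y = G y * D y := by
    intro y
    have hder : ∀ t : ℝ, HasDerivAt (fun t : ℝ => H (y - (t * D y) • v))
        (fderiv ℝ H (y - (t * D y) • v) (-(D y • v))) t := by
      intro t
      have h1 : HasDerivAt (fun t : ℝ => y - (t * D y) • v) (-(D y • v)) t := by
        simpa using (((hasDerivAt_id t).mul_const (D y)).smul_const v).const_sub y
      exact (hHs.differentiable (by simp) _).hasFDerivAt.comp_hasDerivAt t h1
    have hcont : Continuous fun t : ℝ => fderiv ℝ H (y - (t * D y) • v) (-(D y • v)) :=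
      ((hHs.continuous_fderiv (by simp)).comp (by fun_prop)).clm_apply continuous_const
    have key := intervalIntegral.integral_eq_sub_of_hasDerivAt
      (fun t _ => hder t) (hcont.intervalIntegrable 0 1)
    have h0 : H (y - (1 * D y) • v) = 0 := hHz _ (by simp [hv])
    rw [h0] at key
    simp only [map_neg, map_smul, intervalIntegral.integral_neg, zero_mul, zero_smul, sub_zero,
      zero_sub, neg_inj, smul_eq_mul, intervalIntegral.integral_const_mul] at key
    rw [← key, mul_comm]
  refine ⟨U ∩ (Φ.source ∩ Φ ⁻¹' Metric.ball (Ψ p) (ε / 4)),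
    hU.inter (Φ.isOpen_inter_preimage Metric.isOpen_ball),
    ⟨hp, hpS, Metric.mem_ball_self (by positivity)⟩, Set.inter_subset_left,
    G ∘ Ψ, hGs.comp_contDiffOn (hΨs.mono Set.inter_subset_left), ?_⟩
  rintro q ⟨-, hqS, hqB⟩
  have h1 : χ (Ψ q) = 1 := χ.one_of_mem_closedBall (Metric.ball_subset_closedBall hqB)
  have h2 : H (Ψ q) = h q := by
    simp only [hH, h1, one_mul]
    rw [← hΦc, Φ.left_inv hqS]
  rw [← h2, hHG, hΨD]; rfl

namespace Frontal

variable (F : Frontal)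

theorem contDiffOn_lam : ContDiffOn ℝ (⊤ : ℕ∞) F.lam F.U := by
  have h : F.lam = fun p => F.Λ p 0 0 * F.Λ p 1 1 - F.Λ p 0 1 * F.Λ p 1 0 :=
    funext fun p => det_fin_two _
  rw [h]
  exact ((F.smooth_Λ 0 0).mul (F.smooth_Λ 1 1)).sub ((F.smooth_Λ 0 1).mul (F.smooth_Λ 1 0))

theorem contDiffOn_KΩ : ContDiffOn ℝ (⊤ : ℕ∞) F.KΩ F.U := by
  have h : F.KΩ = fun p => F.μ p 0 0 * F.μ p 1 1 - F.μ p 0 1 * F.μ p 1 0 :=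
    funext fun p => det_fin_two _
  rw [h]
  exact ((F.smooth_μ 0 0).mul (F.smooth_μ 1 1)).sub ((F.smooth_μ 0 1).mul (F.smooth_μ 1 0))

theorem det_gram_ne_zero {p : Pt} (hp : p ∈ F.U) : ((F.Ω p)ᵀ * F.Ω p).det ≠ 0 := by
  have h := F.indep p hp
  rw [← dotProduct_self_eq_zero.ne, cross_dot_cross] at h
  convert! h using 1
  simp [det_fin_two, mul_apply, Fin.sum_univ_three, dotProduct]

theorem IImat_eq {p : Pt} (hp : p ∈ F.U) :
    F.IImat p = -(F.Λ p * ((F.Ω p)ᵀ * F.Ω p) * (F.μ p)ᵀ) := by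
  simp only [IImat, IIOf, n]
  rw [F.decomp_x p hp, F.decomp_n p hp]
  simp [Matrix.mul_assoc]

theorem Imat_eq {p : Pt} (hp : p ∈ F.U) :
    F.Imat p = F.Λ p * ((F.Ω p)ᵀ * F.Ω p) * (F.Λ p)ᵀ := by
  simp only [Imat, IOf]
  rw [F.decomp_x p hp]
  simp [Matrix.mul_assoc]

theorem Kg_eq {p : Pt} (hp : p ∈ F.U) (hl : F.lam p ≠ 0) : F.Kg p = F.KΩ p / F.lam p := by
  have hG := F.det_gram_ne_zero hp
  have h1 : F.Kg p = (F.IImat p).det / (F.Imat p).det := rfl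
  have hl' : (F.Λ p).det ≠ 0 := hl
  rw [h1, F.IImat_eq hp, F.Imat_eq hp, det_neg, lam, KΩ]
  simp only [det_mul, det_transpose, Fintype.card_fin] at hG ⊢
  field_simp

theorem differentiableAt_n {p : Pt} (hp : p ∈ F.U) : DifferentiableAt ℝ F.n p := by
  have hΩ : ∀ i j, DifferentiableAt ℝ (fun p => F.Ω p i j) p := fun i j =>
    ((F.smooth_Ω i j).contDiffAt (F.isOpen_U.mem_nhds hp)).differentiableAt (by simp)
  have hw : DifferentiableAt ℝ
      (fun p => crossProduct (fun i => F.Ω p i 0) (fun i => F.Ω p i 1)) p := by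
    rw [differentiableAt_pi]
    intro i
    fin_cases i <;> simp [cross_apply] <;> fun_prop
  have hd : DifferentiableAt ℝ (fun p => crossProduct (fun i => F.Ω p i 0) (fun i => F.Ω p i 1)
      ⬝ᵥ crossProduct (fun i => F.Ω p i 0) (fun i => F.Ω p i 1)) p := by
    simp only [dotProduct]
    have := differentiableAt_pi.1 hw
    fun_prop
  have hne := dotProduct_self_eq_zero.not.2 (F.indep p hp)
  have hpos : 0 < crossProduct (fun i => F.Ω p i 0) (fun i => F.Ω p i 1)
      ⬝ᵥ crossProduct (fun i => F.Ω p i 0) (fun i => F.Ω p i 1) :=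
    lt_of_le_of_ne (Finset.sum_nonneg fun _ _ => mul_self_nonneg _) (Ne.symm hne)
  exact ((hd.sqrt hne).inv (Real.sqrt_pos.2 hpos).ne').smul hw

theorem jac_dotProduct_n {p : Pt} (hp : p ∈ F.U) (i : Fin 2) :
    fderiv ℝ F.x p (Pi.single i 1) ⬝ᵥ F.n p = 0 := by
  have h : fderiv ℝ F.x p (Pi.single i 1) = fun k => (F.Ω p * (F.Λ p)ᵀ) k i := by
    rw [← F.decomp_x p hp]; rfl
  rw [h]
  simp [n, normalOf, dotProduct, Fin.sum_univ_three, cross_apply, mul_apply]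
  ring

theorem IImat_apply {p : Pt} (hp : p ∈ F.U) (i j : Fin 2) :
    F.IImat p i j =
      fderiv ℝ (fderiv ℝ F.x) p (Pi.single j 1) (Pi.single i 1) ⬝ᵥ F.n p := by
  have hx : ContDiffAt ℝ (⊤ : ℕ∞) F.x p := F.smooth_x.contDiffAt (F.isOpen_U.mem_nhds hp)
  have hx1 : HasFDerivAt (fderiv ℝ F.x) (fderiv ℝ (fderiv ℝ F.x) p) p :=
    ((hx.fderiv_right (m := 1) (WithTop.coe_le_coe.2 le_top)).differentiableAt
      one_ne_zero).hasFDerivAt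
  have hxi := hx1.clm_apply (hasFDerivAt_const (Pi.single i 1 : Pt) p)
  have hn := (F.differentiableAt_n hp).hasFDerivAt
  have hsum := HasFDerivAt.fun_sum (u := Finset.univ) fun (k : Fin 3) _ =>
    ((hasFDerivAt_pi'.1 hxi) k).mul ((hasFDerivAt_pi'.1 hn) k)
  have hzero : (fun q => ∑ k, fderiv ℝ F.x q (Pi.single i 1) k * F.n q k) =ᶠ[𝓝 p] fun _ => 0 := by
    filter_upwards [F.isOpen_U.mem_nhds hp] with q hq using F.jac_dotProduct_n hq i
  have h := hsum.unique ((hasFDerivAt_const (0 : ℝ) p).congr_of_eventuallyEq hzero)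
  have h' := DFunLike.congr_fun h (Pi.single j 1 : Pt)
  simp [Fin.sum_univ_three] at h'
  simp [IImat, IIOf, jac, mul_apply, Fin.sum_univ_three, dotProduct]
  linarith

theorem IImat_isSymm {p : Pt} (hp : p ∈ F.U) : (F.IImat p).IsSymm := by
  have hx : ContDiffAt ℝ (⊤ : ℕ∞) F.x p := F.smooth_x.contDiffAt (F.isOpen_U.mem_nhds hp)
  have hs := hx.isSymmSndFDerivAt (by
    rw [minSmoothness_of_isRCLikeNormedField]
    exact WithTop.coe_le_coe.2 le_top)
  refine IsSymm.ext fun i j => ?_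
  rw [F.IImat_apply hp, F.IImat_apply hp, hs.eq]

theorem IImat_eq_zero_iff {p : Pt} (hp : p ∈ F.U) :
    F.IImat p = 0 ↔ F.e p = 0 ∧ F.f p = 0 ∧ F.g p = 0 := by
  have hs := (F.IImat_isSymm hp).apply 0 1
  simp only [e, f, g, ← Matrix.ext_iff, Fin.forall_fin_two, Matrix.zero_apply]
  rw [hs]
  tauto

theorem KΩ_eq_zero_of_IImat_eq_zero {p : Pt} (hp : p ∈ F.U) (hΛ : F.Λ p ≠ 0)
    (h : F.IImat p = 0) : F.KΩ p = 0 := by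
  by_contra hK
  have hμ : IsUnit (F.μ p)ᵀ.det := by rw [det_transpose]; exact isUnit_iff_ne_zero.2 hK
  have hG : IsUnit ((F.Ω p)ᵀ * F.Ω p).det := isUnit_iff_ne_zero.2 (F.det_gram_ne_zero hp)
  rw [F.IImat_eq hp, neg_eq_zero] at h
  apply hΛ
  have h1 := congrArg (· * ((F.μ p)ᵀ)⁻¹ * ((F.Ω p)ᵀ * F.Ω p)⁻¹) h
  simpa only [mul_nonsing_inv_cancel_right _ _ hμ, mul_nonsing_inv_cancel_right _ _ hG,
    Matrix.zero_mul] using h1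

theorem IsWavefront.eq_zero_of_mulVec {F : Frontal} (hW : F.IsWavefront) {p : Pt} (hp : p ∈ F.U)
    {v : Fin 2 → ℝ} (h1 : (F.Λ p)ᵀ *ᵥ v = 0) (h2 : (F.μ p)ᵀ *ᵥ v = 0) : v = 0 := by
  have hr := hW p hp
  have hv : (Matrix.fromRows (jac F.x p) (jac F.n p)) *ᵥ v = 0 := by
    rw [fromRows_mulVec, F.decomp_x p hp, n, F.decomp_n p hp, ← mulVec_mulVec, ← mulVec_mulVec,
      h1, h2]
    ext (i | i) <;> simp
  have hli : LinearIndependent ℝ (Matrix.fromRows (jac F.x p) (jac F.n p)).col := by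
    rw [linearIndependent_iff_card_eq_finrank_span, Set.finrank, ← rank_eq_finrank_span_cols, hr]
    simp
  exact mulVec_injective_iff.2 hli (by simpa using hv)

theorem IImat_eq_zero_of_KΩ_eq_zero (hW : F.IsWavefront) {p : Pt} (hp : p ∈ F.U)
    (hl : F.lam p = 0) (hK : F.KΩ p = 0) : F.IImat p = 0 := by
  obtain ⟨a, ha, hΛa⟩ := exists_mulVec_eq_zero_iff.2
    (show (F.Λ p)ᵀ.det = 0 by rw [det_transpose]; exact hl)
  obtain ⟨b, hb, hμb⟩ := exists_mulVec_eq_zero_iff.2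
    (show (F.μ p)ᵀ.det = 0 by rw [det_transpose]; exact hK)
  have hIb : F.IImat p *ᵥ b = 0 := by
    rw [F.IImat_eq hp, neg_mulVec, ← mulVec_mulVec, hμb, mulVec_zero, neg_zero]
  have hIa : F.IImat p *ᵥ a = 0 := by
    rw [← (F.IImat_isSymm hp).eq, F.IImat_eq hp, transpose_neg, neg_mulVec, transpose_mul,
      transpose_mul, ← mulVec_mulVec, ← mulVec_mulVec, hΛa, mulVec_zero, mulVec_zero, neg_zero]
  have hdet : a 0 * b 1 - a 1 * b 0 ≠ 0 := by
    intro hd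
    have hμa : (F.μ p)ᵀ *ᵥ a ≠ 0 := fun h => ha (hW.eq_zero_of_mulVec hp hΛa h)
    apply hμa
    have key : ∀ i, b i • a = a i • b := by
      intro i; ext j
      fin_cases i <;> fin_cases j <;> simp <;> linarith
    obtain ⟨i, hi⟩ := Function.ne_iff.1 hb
    have : b i • ((F.μ p)ᵀ *ᵥ a) = 0 := by
      rw [← mulVec_smul, key, mulVec_smul, hμb, smul_zero]
    exact (smul_eq_zero.1 this).resolve_left hi
  have row : ∀ i, F.IImat p i 0 = 0 ∧ F.IImat p i 1 = 0 := by
    intro i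
    have h1 := congrFun hIa i
    have h2 := congrFun hIb i
    simp only [mulVec, dotProduct, Fin.sum_univ_two, Pi.zero_apply] at h1 h2
    constructor
    · refine (mul_eq_zero.1 (?_ : _ * (a 0 * b 1 - a 1 * b 0) = 0)).resolve_right hdet
      linear_combination b 1 * h1 - a 1 * h2
    · refine (mul_eq_zero.1 (?_ : _ * (a 0 * b 1 - a 1 * b 0) = 0)).resolve_right hdet
      linear_combination a 0 * h2 - b 0 * h1
  ext i j
  fin_cases j
  · exact (row i).1
  · exact (row i).2

theorem Λ_ne_zero_of_rank_eq_one {p : Pt} (hp : p ∈ F.U) (hr : (jac F.x p).rank = 1) :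
    F.Λ p ≠ 0 := by
  intro h
  rw [F.decomp_x p hp, h] at hr
  simp at hr

theorem eventually_Λ_ne_zero {p : Pt} (hp : p ∈ F.U) (h : F.Λ p ≠ 0) :
    ∀ᶠ q in 𝓝 p, F.Λ q ≠ 0 := by
  obtain ⟨i, j, hij⟩ : ∃ i j, F.Λ p i j ≠ 0 := by
    by_contra! hc
    exact h (Matrix.ext hc)
  have hc := ((F.smooth_Λ i j).contDiffAt (F.isOpen_U.mem_nhds hp)).continuousAt
  filter_upwards [hc.eventually_ne hij] with q hq h0
  exact hq (by rw [h0]; rfl)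

theorem IsProper.KΩ_eq_zero_of_bounded {F : Frontal} (hP : F.IsProper) {W : Set Pt}
    (hWo : IsOpen W) (hWU : W ⊆ F.U) {C : ℝ} (hC : ∀ q ∈ W \ F.sing, |F.Kg q| ≤ C)
    {q : Pt} (hq : q ∈ W) (hqs : q ∈ F.sing) : F.KΩ q = 0 := by
  have hdense : ∃ᶠ z in 𝓝 q, z ∉ F.sing := by
    intro h
    have : q ∈ interior F.sing := mem_interior_iff_mem_nhds.2 (by simpa using h)
    rw [hP] at this
    exact this
  have hle : ∃ᶠ z in 𝓝 q, |F.KΩ z| ≤ C * |F.lam z| := by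
    refine (hdense.and_eventually (hWo.mem_nhds hq)).mono fun z hz => ?_
    have hl : F.lam z ≠ 0 := fun h => hz.1 ⟨hWU hz.2, h⟩
    have := hC z ⟨hz.2, hz.1⟩
    rwa [F.Kg_eq (hWU hz.2) hl, abs_div, div_le_iff₀ (abs_pos.2 hl)] at this
  have hnhds := F.isOpen_U.mem_nhds hqs.1
  have h1 := (F.contDiffOn_KΩ.contDiffAt hnhds).continuousAt
  have h2 := (F.contDiffOn_lam.contDiffAt hnhds).continuousAt
  have h3 : |F.KΩ q| ≤ C * |F.lam q| := by
    by_contra! hlt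
    exact hle (((continuousAt_const.mul h2.abs).eventually_lt h1.abs hlt).mono
      fun z hz => not_le.2 hz)
  rw [hqs.2, abs_zero, mul_zero] at h3
  exact abs_nonpos_iff.1 h3

end Frontal
/-- at a non-degenerated rank-1 singularity of a proper wavefront,
extendibility of `K`, boundedness of `K`, vanishing of `K_Ω` on the nearby
singular set, and vanishing of `e, f, g` on the nearby singular set are all
equivalent. -/
theorem stmt11 (F : Frontal) (hW : F.IsWavefront) (hP : F.IsProper)
    (p : Pt) (hp : p ∈ F.sing) (hnd : fderiv ℝ F.lam p ≠ 0)
    (hr : (jac F.x p).rank = 1) :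
    List.TFAE [
      -- (1) `K` admits a `C^∞` extension to some open neighborhood of `p`
      F.SmoothExtNear F.Kg p,
      -- (2) `K` is bounded on `W − Σ(x)` for some neighborhood `W` of `p`
      ∃ W ∈ nhds p, W ⊆ F.U ∧ ∃ C : ℝ, ∀ q ∈ W \ F.sing, |F.Kg q| ≤ C,
      -- (3) `K_Ω` vanishes on `V ∩ Σ(x)` for some neighborhood `V` of `p`
      ∃ V : Set Pt, IsOpen V ∧ p ∈ V ∧ V ⊆ F.U ∧ ∀ q ∈ V ∩ F.sing, F.KΩ q = 0,
      -- (4) `e, f, g` vanish on `V ∩ Σ(x)` for some neighborhood `V` of `p`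
      ∃ V : Set Pt, IsOpen V ∧ p ∈ V ∧ V ⊆ F.U ∧
        ∀ q ∈ V ∩ F.sing, F.e q = 0 ∧ F.f q = 0 ∧ F.g q = 0] := by
  have hpU : p ∈ F.U := hp.1
  tfae_have 1 → 2 := by
    rintro ⟨V, hVo, hpV, hVU, G, hG, hGK⟩
    have hc : ContinuousAt G p := (hG.contDiffAt (hVo.mem_nhds hpV)).continuousAt
    have hb := hc.abs.eventually_lt continuousAt_const (lt_add_one |G p|)
    refine ⟨V ∩ {q | |G q| < |G p| + 1}, inter_mem (hVo.mem_nhds hpV) hb,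
      fun q hq => hVU hq.1, |G p| + 1, fun q hq => ?_⟩
    rw [← hGK q ⟨hq.1.1, hVU hq.1.1, fun h => hq.2 ⟨hVU hq.1.1, h⟩⟩]
    exact le_of_lt hq.1.2
  tfae_have 2 → 3 := by
    rintro ⟨W, hWp, hWU, C, hC⟩
    refine ⟨interior W, isOpen_interior, mem_interior_iff_mem_nhds.2 hWp,
      interior_subset.trans hWU, fun q hq => ?_⟩
    exact hP.KΩ_eq_zero_of_bounded isOpen_interior (interior_subset.trans hWU)
      (fun z hz => hC z ⟨interior_subset hz.1, hz.2⟩) hq.1 hq.2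
  tfae_have 3 → 1 := by
    rintro ⟨V, hVo, hpV, hVU, hV⟩
    obtain ⟨V', hVo', hpV', hVV', φ, hφ, hφe⟩ := exists_smooth_div_of_eq_zero_on_zeroLocus hVo hpV
      (F.contDiffOn_lam.mono hVU) (F.contDiffOn_KΩ.mono hVU) hnd
      (fun q hq hl => hV q ⟨hq, hVU hq, hl⟩)
    refine ⟨V', hVo', hpV', hVV'.trans hVU, φ, hφ, fun q hq => ?_⟩
    rw [F.Kg_eq hq.2.1 hq.2.2, hφe q hq.1, mul_div_cancel_right₀ _ hq.2.2]
  tfae_have 3 → 4 := by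
    rintro ⟨V, hVo, hpV, hVU, hV⟩
    exact ⟨V, hVo, hpV, hVU, fun q hq => (F.IImat_eq_zero_iff hq.2.1).1
      (F.IImat_eq_zero_of_KΩ_eq_zero hW hq.2.1 hq.2.2 (hV q hq))⟩
  tfae_have 4 → 3 := by
    rintro ⟨V, hVo, hpV, hVU, hV⟩
    obtain ⟨N, hN, hNo, hpN⟩ := eventually_nhds_iff.1
      (F.eventually_Λ_ne_zero hpU (F.Λ_ne_zero_of_rank_eq_one hpU hr))
    exact ⟨V ∩ N, hVo.inter hNo, ⟨hpV, hpN⟩, fun q hq => hVU hq.1, fun q hq =>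
      F.KΩ_eq_zero_of_IImat_eq_zero hq.2.1 (hN q hq.1.2)
        ((F.IImat_eq_zero_iff hq.2.1).2 (hV q ⟨hq.1.1, hq.2⟩))⟩
  tfae_finish
end
end

section
/- Let x : U → ℝ³ be a wavefront, Ω a tmb of x, and p ∈ Σ(x) with rank(Dx(p)) = 1, K_Ω(p) = 0 and H_Ω(p) < 0. Then the following are equivalent: (1) x is parallelly smoothable at p; (2) H(u,v) tends to +∞ or tends to −∞ as (u,v) → p through Σ(x)ᶜ; (3) k₁(u,v) tends to +∞ or tends to −∞ as (u,v) → p through Σ(x)ᶜ; (4) λ_Ω does not change sign on some open neighborhood of p. (The analogous statement with k₂ in (3) holds when H_Ω(p) > 0.) -/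
/- Common framework for frontals and tangent moving bases, following
   "Curvatures on fronts" conventions. -/

noncomputable section

open Matrix Topology Filter

theorem rank_eq_two_iff_det_ne_zero (A : Matrix (Fin 2) (Fin 2) ℝ) :
    A.rank = 2 ↔ A.det ≠ 0 := by
  rw [← isUnit_iff_ne_zero, ← Matrix.isUnit_iff_isUnit_det,
    ← Matrix.linearIndependent_cols_iff_isUnit, linearIndependent_iff_card_eq_finrank_span,
    Matrix.rank_eq_finrank_span_cols, Fintype.card_fin, eq_comm]
  rfl

theorem det_transpose_mul_self_eq_cross (A : Matrix (Fin 3) (Fin 2) ℝ) :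
    (Aᵀ * A).det = crossProduct (fun i => A i 0) (fun i => A i 1) ⬝ᵥ
      crossProduct (fun i => A i 0) (fun i => A i 1) := by
  simp [Matrix.det_fin_two, Matrix.mul_apply, Fin.sum_univ_three, cross_apply, dotProduct]
  ring

theorem rank_mul_transpose_eq_two_iff {A : Matrix (Fin 3) (Fin 2) ℝ} (hA : (Aᵀ * A).det ≠ 0)
    (M : Matrix (Fin 2) (Fin 2) ℝ) : (A * Mᵀ).rank = 2 ↔ M.det ≠ 0 := by
  rw [← Matrix.rank_transpose_mul_self, rank_eq_two_iff_det_ne_zero]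
  have h : (A * Mᵀ)ᵀ * (A * Mᵀ) = M * (Aᵀ * A) * Mᵀ := by
    simp [Matrix.mul_assoc]
  rw [h, Matrix.det_mul, Matrix.det_mul, Matrix.det_transpose]
  simp [hA]

theorem det_add_smul_fin_two (A B : Matrix (Fin 2) (Fin 2) ℝ) (l : ℝ) :
    (A + l • B).det = A.det + l * (B * A.adjugate).trace + l ^ 2 * B.det := by
  simp [Matrix.det_fin_two, Matrix.adjugate_fin_two, Matrix.trace_fin_two, Matrix.mul_apply]
  ring

/-- A quotient with negative numerator and denominator vanishing at `p` diverges to a signed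
infinity exactly when the denominator has constant sign near `p`. -/
theorem tendsto_div_atTop_or_atBot_iff {X : Type*} [TopologicalSpace X] {f g d : X → ℝ} {p : X}
    {s : Set X} (hg : ContinuousAt g p) (hd : ContinuousAt d p) (hgp : g p < 0) (hdp : d p = 0)
    (hs : ∀ᶠ q in 𝓝 p, q ∈ s ↔ d q ≠ 0) (hf : ∀ q ∈ s, f q = g q / d q) :
    (Tendsto f (𝓝[s] p) atTop ∨ Tendsto f (𝓝[s] p) atBot) ↔
      ((∀ᶠ q in 𝓝 p, 0 ≤ d q) ∨ ∀ᶠ q in 𝓝 p, d q ≤ 0) := by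
  have hg0 : ∀ᶠ q in 𝓝 p, g q < 0 := hg.eventually_lt_const hgp
  have hgt : Tendsto g (𝓝[s] p) (𝓝 (g p)) := hg.tendsto.mono_left nhdsWithin_le_nhds
  have hdt : Tendsto d (𝓝[s] p) (𝓝 0) := by
    simpa [hdp] using hd.tendsto.mono_left (nhdsWithin_le_nhds (s := s))
  have hff : (fun q => g q * (d q)⁻¹) =ᶠ[𝓝[s] p] f := by
    filter_upwards [self_mem_nhdsWithin] with q hq
    rw [hf q hq, div_eq_mul_inv]
  constructor
  · rintro (h | h)
    · right
      filter_upwards [hg0, hs, eventually_nhdsWithin_iff.1 (h.eventually_gt_atTop 0)]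
        with q hgq hsq hfq
      by_contra! hlt
      have hq := hsq.2 hlt.ne'
      have := hfq hq
      rw [hf q hq] at this
      exact (div_neg_of_neg_of_pos hgq hlt).not_gt this
    · left
      filter_upwards [hg0, hs, eventually_nhdsWithin_iff.1 (h.eventually_lt_atBot 0)]
        with q hgq hsq hfq
      by_contra! hlt
      have hq := hsq.2 hlt.ne
      have := hfq hq
      rw [hf q hq] at this
      exact (div_pos_of_neg_of_neg hgq hlt).not_gt this
  · rintro (h | h)
    · right
      have hpos : ∀ᶠ q in 𝓝[s] p, d q ∈ Set.Ioi 0 := by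
        filter_upwards [nhdsWithin_le_nhds hs, nhdsWithin_le_nhds h, self_mem_nhdsWithin]
          with q hsq hq hqs
        exact lt_of_le_of_ne hq (hsq.1 hqs).symm
      exact (hgt.neg_mul_atTop hgp (tendsto_inv_nhdsGT_zero.comp
        (tendsto_nhdsWithin_iff.2 ⟨hdt, hpos⟩))).congr' hff
    · left
      have hneg : ∀ᶠ q in 𝓝[s] p, d q ∈ Set.Iio 0 := by
        filter_upwards [nhdsWithin_le_nhds hs, nhdsWithin_le_nhds h, self_mem_nhdsWithin]
          with q hsq hq hqs
        exact lt_of_le_of_ne hq (hsq.1 hqs)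
      exact (hgt.neg_mul_atBot hgp (tendsto_inv_nhdsLT_zero.comp
        (tendsto_nhdsWithin_iff.2 ⟨hdt, hneg⟩))).congr' hff

/-- If `a` and `a + l b + l² c` (for small `l > 0`) are considered near a zero `p` of `a` with
`b p > 0`, then the latter avoids zero near `p` exactly when `a ≥ 0` near `p`. -/
theorem exists_quadratic_ne_zero_iff {E : Type*} [NormedAddCommGroup E] [NormedSpace ℝ E]
    {a b c : E → ℝ} {p : E} (ha : ∀ᶠ q in 𝓝 p, ContinuousAt a q)
    (hb : ∀ᶠ q in 𝓝 p, ContinuousAt b q) (hc : ∀ᶠ q in 𝓝 p, ContinuousAt c q)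
    (hap : a p = 0) (hbp : 0 < b p) :
    (∃ ε > (0 : ℝ), ∀ᶠ q in 𝓝 p, ∀ l ∈ Set.Ioo 0 ε, a q + l * b q + l ^ 2 * c q ≠ 0) ↔
      ∀ᶠ q in 𝓝 p, 0 ≤ a q := by
  constructor
  · rintro ⟨ε, hε, h⟩
    obtain ⟨r, hr, hball⟩ := Metric.eventually_nhds_iff_ball.1 (h.and (ha.and (hb.and hc)))
    filter_upwards [Metric.ball_mem_nhds p hr] with q hq
    have hpos_at : ∀ᶠ l in 𝓝[>] (0 : ℝ), 0 < b p + l * c p := by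
      have : ContinuousAt (fun l : ℝ => b p + l * c p) 0 := by fun_prop
      exact nhdsWithin_le_nhds (this.eventually_const_lt (by simpa using hbp))
    have hnonneg : ∀ᶠ l in 𝓝[>] (0 : ℝ), 0 ≤ a q + l * b q + l ^ 2 * c q := by
      filter_upwards [hpos_at, Ioo_mem_nhdsGT hε] with l hl hlε
      by_contra! hlt
      have hcont : ContinuousOn (fun z => a z + l * b z + l ^ 2 * c z) (Metric.ball p r) := by
        intro z hz
        obtain ⟨-, h1, h2, h3⟩ := hball z hz
        exact ContinuousAt.continuousWithinAt (by fun_prop)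
      have hp0 : 0 ≤ a p + l * b p + l ^ 2 * c p := by
        rw [hap]
        nlinarith [mul_pos hlε.1 hl]
      obtain ⟨z, hz, hz0⟩ := (convex_ball p r).isPreconnected.intermediate_value hq
        (Metric.mem_ball_self hr) hcont ⟨hlt.le, hp0⟩
      exact (hball z hz).1 l hlε hz0
    have hlim : Tendsto (fun l : ℝ => a q + l * b q + l ^ 2 * c q) (𝓝[>] 0) (𝓝 (a q)) := by
      have : ContinuousAt (fun l : ℝ => a q + l * b q + l ^ 2 * c q) 0 := by fun_prop
      simpa using this.tendsto.mono_left nhdsWithin_le_nhds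
    exact ge_of_tendsto hlim hnonneg
  · intro h
    have hb' := hb.self_of_nhds
    have hc' := hc.self_of_nhds
    have h1 : ContinuousAt (fun z : E × ℝ => b z.1 + z.2 * c z.1) (p, 0) := by
      have hb1 : ContinuousAt (fun z : E × ℝ => b z.1) (p, 0) :=
        ContinuousAt.comp (f := Prod.fst) hb' continuousAt_fst
      have hc1 : ContinuousAt (fun z : E × ℝ => c z.1) (p, 0) :=
        ContinuousAt.comp (f := Prod.fst) hc' continuousAt_fst
      fun_prop
    have h2 := h1.eventually_const_lt (u := 0) (by simpa using hbp)
    rw [nhds_prod_eq] at h2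
    obtain ⟨P, hP, Q, hQ, hPQ⟩ := Filter.eventually_prod_iff.1 h2
    obtain ⟨ε, hε, hεQ⟩ := Metric.eventually_nhds_iff_ball.1 hQ
    refine ⟨ε, hε, ?_⟩
    filter_upwards [h, hP] with q hq hPq l hl
    have := hPQ hPq (hεQ l (by simpa [abs_of_pos hl.1] using hl.2))
    dsimp only at this
    have := mul_pos hl.1 this
    nlinarith

theorem differentiableAt_normalOf {Ω : Pt → Matrix (Fin 3) (Fin 2) ℝ} {q : Pt}
    (hΩ : ∀ i j, DifferentiableAt ℝ (fun p => Ω p i j) q)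
    (h0 : crossProduct (fun i => Ω q i 0) (fun i => Ω q i 1) ≠ 0) :
    DifferentiableAt ℝ (normalOf Ω) q := by
  have hcross : DifferentiableAt ℝ
      (fun p => crossProduct (fun i => Ω p i 0) (fun i => Ω p i 1)) q := by
    rw [differentiableAt_pi]
    intro i
    fin_cases i <;> simp only [cross_apply] <;> simp <;> fun_prop
  have hdot : DifferentiableAt ℝ (fun p => crossProduct (fun i => Ω p i 0) (fun i => Ω p i 1) ⬝ᵥ
      crossProduct (fun i => Ω p i 0) (fun i => Ω p i 1)) q := by
    have hi := differentiableAt_pi.1 hcross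
    unfold dotProduct
    fun_prop
  have hne : crossProduct (fun i => Ω q i 0) (fun i => Ω q i 1) ⬝ᵥ
      crossProduct (fun i => Ω q i 0) (fun i => Ω q i 1) ≠ 0 := by
    simpa [dotProduct_self_eq_zero] using h0
  refine ((hdot.sqrt hne).inv ?_).smul hcross
  exact (Real.sqrt_pos.2 (lt_of_le_of_ne (Finset.sum_nonneg fun i _ => mul_self_nonneg _)
    hne.symm)).ne'

namespace Frontal

variable (F : Frontal) {q : Pt}

theorem det_transpose_mul_self_ne_zero (hq : q ∈ F.U) : ((F.Ω q)ᵀ * F.Ω q).det ≠ 0 := by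
  rw [det_transpose_mul_self_eq_cross]
  simpa [dotProduct_self_eq_zero] using F.indep q hq

theorem jac_parallel (hq : q ∈ F.U) (l : ℝ) :
    jac (fun z => F.x z + l • F.n z) q = F.Ω q * (F.Λ q + l • F.μ q)ᵀ := by
  have hU := F.isOpen_U.mem_nhds hq
  have hx : DifferentiableAt ℝ F.x q := (F.smooth_x.contDiffAt hU).differentiableAt (by simp)
  have hn : DifferentiableAt ℝ F.n q := differentiableAt_normalOf
    (fun i j => ((F.smooth_Ω i j).contDiffAt hU).differentiableAt (by simp)) (F.indep q hq)
  have h : jac (fun z => F.x z + l • F.n z) q = jac F.x q + l • jac F.n q := by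
    have hd : HasFDerivAt (fun z => F.x z + l • F.n z) (fderiv ℝ F.x q + l • fderiv ℝ F.n q) q :=
      hx.hasFDerivAt.add (hn.hasFDerivAt.const_smul l)
    ext i j
    simp [jac, hd.fderiv]
  have hn' : jac F.n q = F.Ω q * (F.μ q)ᵀ := F.decomp_n q hq
  rw [h, F.decomp_x q hq, hn', Matrix.transpose_add, Matrix.transpose_smul, Matrix.mul_add,
    Matrix.mul_smul]

theorem rank_jac_parallel_eq_two_iff (hq : q ∈ F.U) (l : ℝ) :
    (jac (fun z => F.x z + l • F.n z) q).rank = 2 ↔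
      F.lam q + l * (-2 * F.HΩ q) + l ^ 2 * F.KΩ q ≠ 0 := by
  rw [F.jac_parallel hq, rank_mul_transpose_eq_two_iff (F.det_transpose_mul_self_ne_zero hq),
    det_add_smul_fin_two]
  have h : -2 * F.HΩ q = (F.μ q * (F.Λ q).adjugate).trace := by
    simp only [HΩ, αΩ]
    ring
  rw [h]
  rfl

theorem continuousAt_lam (hq : q ∈ F.U) : ContinuousAt F.lam q := by
  have h i j := (F.smooth_Λ i j).continuousOn.continuousAt (F.isOpen_U.mem_nhds hq)
  unfold lam
  simp only [Matrix.det_fin_two]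
  fun_prop

theorem continuousAt_KΩ (hq : q ∈ F.U) : ContinuousAt F.KΩ q := by
  have h i j := (F.smooth_μ i j).continuousOn.continuousAt (F.isOpen_U.mem_nhds hq)
  unfold KΩ
  simp only [Matrix.det_fin_two]
  fun_prop

theorem continuousAt_HΩ (hq : q ∈ F.U) : ContinuousAt F.HΩ q := by
  have h i j := (F.smooth_μ i j).continuousOn.continuousAt (F.isOpen_U.mem_nhds hq)
  have h' i j := (F.smooth_Λ i j).continuousOn.continuousAt (F.isOpen_U.mem_nhds hq)
  unfold HΩ αΩ
  simp only [Matrix.trace_fin_two, Matrix.mul_apply, Fin.sum_univ_two, Matrix.adjugate_fin_two,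
    Matrix.of_apply, Matrix.cons_val_zero, Matrix.cons_val_one]
  fun_prop

theorem continuousAt_k1Ω (hq : q ∈ F.U) : ContinuousAt F.k1Ω q := by
  have h1 := F.continuousAt_HΩ hq
  have h2 := F.continuousAt_lam hq
  have h3 := F.continuousAt_KΩ hq
  unfold k1Ω
  fun_prop

theorem Imat_eq_s13 (hq : q ∈ F.U) :
    IOf F.x q = F.Λ q * ((F.Ω q)ᵀ * F.Ω q) * (F.Λ q)ᵀ := by
  simp [IOf, F.decomp_x q hq, Matrix.mul_assoc]

theorem IImat_eq_s13 (hq : q ∈ F.U) :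
    IIOf F.x F.n q = -(F.Λ q * ((F.Ω q)ᵀ * F.Ω q) * (F.μ q)ᵀ) := by
  have hn' : jac F.n q = F.Ω q * (F.μ q)ᵀ := F.decomp_n q hq
  simp [IIOf, F.decomp_x q hq, hn', Matrix.mul_assoc]

theorem Wein_eq (hq : q ∈ F.reg) : weinOf F.x F.n q = (F.lam q)⁻¹ • F.αΩ q := by
  have hG : IsUnit ((F.Ω q)ᵀ * F.Ω q).det := (F.det_transpose_mul_self_ne_zero hq.1).isUnit
  have hL : IsUnit ((F.Λ q)ᵀ).det := by
    rw [Matrix.det_transpose]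
    exact (show (F.Λ q).det ≠ 0 from hq.2).isUnit
  have hII : (IIOf F.x F.n q)ᵀ = -(F.μ q * (((F.Ω q)ᵀ * F.Ω q) * (F.Λ q)ᵀ)) := by
    simp [F.IImat_eq_s13 hq.1, Matrix.mul_assoc]
  have hI : (IOf F.x q)⁻¹ = (((F.Ω q)ᵀ * F.Ω q) * (F.Λ q)ᵀ)⁻¹ * (F.Λ q)⁻¹ := by
    rw [F.Imat_eq_s13 hq.1, Matrix.mul_assoc, Matrix.mul_inv_rev]
  rw [weinOf, hII, hI, Matrix.neg_mul, neg_neg, Matrix.mul_assoc,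
    Matrix.mul_nonsing_inv_cancel_left _ _ (by rw [Matrix.det_mul]; exact hG.mul hL),
    Matrix.inv_def, Ring.inverse_eq_inv', Matrix.mul_smul]
  rfl

theorem Hm_eq (hq : q ∈ F.reg) : F.Hm q = F.HΩ q / F.lam q := by
  rw [Hm, HmOf, F.Wein_eq hq, Matrix.trace_smul, HΩ, smul_eq_mul]
  ring

theorem Kg_eq_s13 (hq : q ∈ F.reg) : F.Kg q = F.KΩ q / F.lam q := by
  have hG := F.det_transpose_mul_self_ne_zero hq.1
  have hL : (F.Λ q).det ≠ 0 := hq.2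
  rw [Kg, KgOf, F.Imat_eq_s13 hq.1, F.IImat_eq_s13 hq.1, Matrix.det_neg, Matrix.det_mul (_ * _),
    Matrix.det_mul (_ * _), Matrix.det_mul (F.Λ q), KΩ, lam]
  simp only [Matrix.det_transpose, Fintype.card_fin]
  field_simp

theorem k1_eq (hq : q ∈ F.reg) : F.k1 q = F.k1Ω q / F.lam q := by
  have hL : F.lam q ≠ 0 := hq.2
  have hdisc : F.Hm q ^ 2 - F.Kg q = (F.HΩ q ^ 2 - F.lam q * F.KΩ q) / F.lam q ^ 2 := by
    rw [F.Hm_eq hq, F.Kg_eq_s13 hq]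
    field_simp
  rw [k1, κm, κp, hdisc, Real.sqrt_div' _ (sq_nonneg _), Real.sqrt_sq_eq_abs, F.Hm_eq hq, k1Ω]
  split_ifs with h
  · rw [abs_of_pos h, sub_div]
  · rw [abs_of_neg (lt_of_le_of_ne (not_lt.1 h) hL), div_neg, sub_div, ← sub_eq_add_neg]

theorem parSmoothable_iff {p : Pt} (hp : p ∈ F.U) (hlam : F.lam p = 0) (hH : F.HΩ p < 0) :
    F.ParSmoothable p ↔ (∀ᶠ q in 𝓝 p, 0 ≤ F.lam q) ∨ ∀ᶠ q in 𝓝 p, F.lam q ≤ 0 := by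
  have hU : ∀ᶠ q in 𝓝 p, q ∈ F.U := F.isOpen_U.mem_nhds hp
  have hposlam := exists_quadratic_ne_zero_iff (a := F.lam) (b := fun q => -2 * F.HΩ q)
    (c := F.KΩ) (hU.mono fun q hq => F.continuousAt_lam hq)
    (hU.mono fun q hq => (F.continuousAt_HΩ hq).const_mul _)
    (hU.mono fun q hq => F.continuousAt_KΩ hq) hlam (by linarith)
  have hneglam := exists_quadratic_ne_zero_iff (a := fun q => -F.lam q)
    (b := fun q => -2 * F.HΩ q) (c := fun q => -F.KΩ q)
    (hU.mono fun q hq => (F.continuousAt_lam hq).neg)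
    (hU.mono fun q hq => (F.continuousAt_HΩ hq).const_mul _)
    (hU.mono fun q hq => (F.continuousAt_KΩ hq).neg) (by simp [hlam]) (by linarith)
  simp only [neg_nonneg] at hneglam
  rw [← hposlam, ← hneglam]
  constructor
  · rintro ⟨ε, hε, V, hV, hpV, hVU, h | h⟩
    · refine .inl ⟨ε, hε, ?_⟩
      filter_upwards [hV.mem_nhds hpV] with q hq l hl
      exact (F.rank_jac_parallel_eq_two_iff (hVU hq) l).1 (h q hq l hl)
    · refine .inr ⟨ε, hε, ?_⟩
      filter_upwards [hV.mem_nhds hpV] with q hq l hl h0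
      exact (F.rank_jac_parallel_eq_two_iff (hVU hq) (-l)).1
        (h q hq (-l) ⟨by linarith [hl.2], by linarith [hl.1]⟩) (by linarith)
  · rintro (⟨ε, hε, h⟩ | ⟨ε, hε, h⟩)
    · obtain ⟨V, hVs, hV, hpV⟩ := eventually_nhds_iff.1 (h.and hU)
      exact ⟨ε, hε, V, hV, hpV, fun q hq => (hVs q hq).2, .inl fun q hq l hl =>
        (F.rank_jac_parallel_eq_two_iff (hVs q hq).2 l).2 ((hVs q hq).1 l hl)⟩
    · obtain ⟨V, hVs, hV, hpV⟩ := eventually_nhds_iff.1 (h.and hU)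
      refine ⟨ε, hε, V, hV, hpV, fun q hq => (hVs q hq).2, .inr fun q hq l hl =>
        (F.rank_jac_parallel_eq_two_iff (hVs q hq).2 l).2 fun h0 => ?_⟩
      exact (hVs q hq).1 (-l) ⟨by linarith [hl.2], by linarith [hl.1]⟩ (by linarith)

end Frontal

theorem exists_noSignChange_iff {f : Pt → ℝ} {U : Set Pt} {p : Pt} (hU : U ∈ 𝓝 p) :
    (∃ V : Set Pt, IsOpen V ∧ p ∈ V ∧ V ⊆ U ∧ NoSignChange f V) ↔
      (∀ᶠ q in 𝓝 p, 0 ≤ f q) ∨ ∀ᶠ q in 𝓝 p, f q ≤ 0 := by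
  constructor
  · rintro ⟨V, hV, hpV, -, h | h⟩
    · exact .inl (mem_of_superset (hV.mem_nhds hpV) h)
    · exact .inr (mem_of_superset (hV.mem_nhds hpV) h)
  · rintro (h | h)
    · obtain ⟨V, hVs, hV, hpV⟩ := eventually_nhds_iff.1 (h.and hU)
      exact ⟨V, hV, hpV, fun q hq => (hVs q hq).2, .inl fun q hq => (hVs q hq).1⟩
    · obtain ⟨V, hVs, hV, hpV⟩ := eventually_nhds_iff.1 (h.and hU)
      exact ⟨V, hV, hpV, fun q hq => (hVs q hq).2, .inr fun q hq => (hVs q hq).1⟩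

/-- at a rank-1 singularity with `K_Ω(p) = 0` and `H_Ω(p) < 0`,
parallel smoothability is equivalent to divergence of `H`, of `k₁`, and to
`λ_Ω` not changing sign near `p`. -/
theorem stmt13 (F : Frontal) (hW : F.IsWavefront)
    (p : Pt) (hp : p ∈ F.sing) (hr : (jac F.x p).rank = 1)
    (hK : F.KΩ p = 0) (hH : F.HΩ p < 0) :
    List.TFAE [
      F.ParSmoothable p,
      Tendsto F.Hm (nhdsWithin p F.reg) atTop ∨
        Tendsto F.Hm (nhdsWithin p F.reg) atBot,
      Tendsto F.k1 (nhdsWithin p F.reg) atTop ∨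
        Tendsto F.k1 (nhdsWithin p F.reg) atBot,
      ∃ V : Set Pt, IsOpen V ∧ p ∈ V ∧ V ⊆ F.U ∧ NoSignChange F.lam V] := by
  obtain ⟨hpU, hlam⟩ := hp
  have hU := F.isOpen_U.mem_nhds hpU
  have hreg : ∀ᶠ q in 𝓝 p, q ∈ F.reg ↔ F.lam q ≠ 0 := by
    filter_upwards [hU] with q hq
    exact ⟨fun h => h.2, fun h => ⟨hq, h⟩⟩
  have hk : F.k1Ω p < 0 := by
    have := Real.sqrt_nonneg (F.HΩ p ^ 2 - F.lam p * F.KΩ p)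
    rw [Frontal.k1Ω]
    linarith
  have h1 := (F.parSmoothable_iff hpU hlam hH).trans (exists_noSignChange_iff hU).symm
  have h2 := (tendsto_div_atTop_or_atBot_iff (F.continuousAt_HΩ hpU) (F.continuousAt_lam hpU) hH
    hlam hreg fun q hq => F.Hm_eq hq).trans (exists_noSignChange_iff hU).symm
  have h3 := (tendsto_div_atTop_or_atBot_iff (F.continuousAt_k1Ω hpU) (F.continuousAt_lam hpU) hk
    hlam hreg fun q hq => F.k1_eq hq).trans (exists_noSignChange_iff hU).symm
  tfae_have 1 ↔ 4 := h1
  tfae_have 2 ↔ 4 := h2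
  tfae_have 3 ↔ 4 := h3
  tfae_finish
end
end
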